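/- Let n ≥ 2 and let A ⊆ F_5^n be sum-free. Suppose there exist a codimension-1 subspace W < F_5^n, v ∈ F_5^n \ W, and x₁, x₂, x₃ ∈ F_5 such that |A ∩ ({x₁v, x₂v, x₃v} + W)| > 26 · 5^{n−3}. Then A is normal. -/

import Mathlib

open Pointwise

/-- `C` is a union of cosets of a subgroup `H` with `s ≤ |C| + |H|`. -/
def PeriodicBound {G : Type*} [AddCommGroup G] (s : ℕ) (C : Finset G) : Prop :=
  ∃ H : AddSubgroup G, (∀ c ∈ C, ∀ h ∈ H, c + h ∈ C) ∧ s ≤ C.card + Nat.card H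

lemma AddSubgroup.natCard_eq_card_filter {G : Type*} [AddCommGroup G] [Fintype G]
    (H : AddSubgroup G) [DecidablePred (· ∈ H)] :
    Nat.card H = Finset.card {x : G | x ∈ H} := by
  rw [Nat.card_eq_fintype_card]
  exact Fintype.card_subtype _

section Kneser

variable {G : Type*} [AddCommGroup G] [Fintype G] [DecidableEq G]

lemma card_mul_card_le_of_add_mem (H₁ H₂ : AddSubgroup G) (P Q D : Finset G) (x : G)
    (hP : ∀ a ∈ P, a ∈ H₁) (hQ : ∀ b ∈ Q, b ∈ H₂) (hD : ∀ a ∈ P, ∀ b ∈ Q, x + a + b ∈ D) :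
    P.card * Q.card ≤ Nat.card (H₁ ⊓ H₂ : AddSubgroup G) * D.card := by
  classical
  rw [← Finset.card_product]
  refine (Finset.card_le_mul_card_image_of_maps_to (f := fun y : G × G => x + y.1 + y.2)
    (t := D) ?_ (Nat.card (H₁ ⊓ H₂ : AddSubgroup G)) ?_)
  · rintro ⟨a, b⟩ hab
    rw [Finset.mem_product] at hab
    exact hD a hab.1 b hab.2
  · intro d _
    rcases Finset.eq_empty_or_nonempty
      {y ∈ P ×ˢ Q | x + y.1 + y.2 = d} with h | ⟨⟨a₀, b₀⟩, h₀⟩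
    · rw [h]; simp
    · simp only [Finset.mem_filter, Finset.mem_product] at h₀
      rw [AddSubgroup.natCard_eq_card_filter]
      refine Finset.card_le_card_of_injOn (fun y => y.1 - a₀) ?_ ?_
      · rintro ⟨a, b⟩ h
        simp only [Finset.coe_filter, Finset.mem_product, Set.mem_ofPred_eq] at h
        have h1 : a - a₀ = b₀ - b := by
          have := h.2.trans h₀.2.symm
          have h2 : a + b = a₀ + b₀ := by
            rw [add_assoc, add_assoc] at this
            exact add_left_cancel this
          rw [sub_eq_sub_iff_add_eq_add, h2, add_comm]
        have h2 : a - a₀ ∈ H₁ := H₁.sub_mem (hP _ h.1.1) (hP _ h₀.1.1)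
        have h3 : a - a₀ ∈ H₂ := h1 ▸ H₂.sub_mem (hQ _ h₀.1.2) (hQ _ h.1.2)
        simpa using ⟨h2, h3⟩
      · rintro ⟨a, b⟩ h ⟨a', b'⟩ h' e
        simp only [Finset.coe_filter, Finset.mem_product, Set.mem_ofPred_eq] at h h' e
        have e1 : a = a' := by simpa using e
        subst e1
        have := h.2.trans h'.2.symm
        simp at this
        simp [this]

/-- The counting step for one coset of `H₁ + H₂` meeting `C₂ \ C₁`. -/
lemma grid_count {H₁ H₂ : AddSubgroup G} {C₁ C₂ : Finset G}
    (h₁ : ∀ c ∈ C₁, ∀ h ∈ H₁, c + h ∈ C₁) (h₂ : ∀ c ∈ C₂, ∀ h ∈ H₂, c + h ∈ C₂)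
    {x : G} (hx₂ : x ∈ C₂) (hx₁ : x ∉ C₁)
    (hX : (C₂ \ C₁).card + Nat.card (H₁ ⊓ H₂ : AddSubgroup G) < Nat.card H₁)
    (hY : (C₁ \ C₂).card + Nat.card (H₁ ⊓ H₂ : AddSubgroup G) < Nat.card H₂) :
    Nat.card H₂ ≤ (C₂ \ C₁).card := by
  classical
  set k := Nat.card (H₁ ⊓ H₂ : AddSubgroup G) with hk
  set P : Finset G := {a | a ∈ H₁ ∧ x + a ∈ C₂} with hP
  set P' : Finset G := {a | a ∈ H₁ ∧ x + a ∉ C₂} with hP'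
  set Q : Finset G := {a | a ∈ H₂ ∧ x + a ∉ C₁} with hQ
  set Q' : Finset G := {a | a ∈ H₂ ∧ x + a ∈ C₁} with hQ'
  have n₁ : ∀ c, c ∉ C₁ → ∀ h ∈ H₁, c + h ∉ C₁ := fun c hc h hh hm =>
    hc (by simpa using h₁ _ hm (-h) (H₁.neg_mem hh))
  have n₂ : ∀ c, c ∉ C₂ → ∀ h ∈ H₂, c + h ∉ C₂ := fun c hc h hh hm =>
    hc (by simpa using h₂ _ hm (-h) (H₂.neg_mem hh))
  have cardH : ∀ (H : AddSubgroup G) (p : G → Prop) [DecidablePred p],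
      Finset.card {a | a ∈ H ∧ p a} + Finset.card {a | a ∈ H ∧ ¬ p a} = Nat.card H := by
    intro H p _
    rw [AddSubgroup.natCard_eq_card_filter]
    rw [← Finset.filter_filter, ← Finset.filter_filter, Finset.card_filter_add_card_filter_not]
  have eP : P.card + P'.card = Nat.card H₁ := cardH H₁ (fun a => x + a ∈ C₂)
  have eQ : Q'.card + Q.card = Nat.card H₂ := cardH H₂ (fun a => x + a ∈ C₁)
  have kle : ∀ (R : Finset G) (y : G), (∀ h ∈ H₁ ⊓ H₂, y + h ∈ R) → k ≤ R.card := by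
    intro R y hR
    rw [hk, AddSubgroup.natCard_eq_card_filter]
    refine Finset.card_le_card_of_injOn (fun h => y + h) (fun h hh => hR h (by simpa using hh)) ?_
    intro a _ b _ e
    simpa using e
  have kP : k ≤ P.card := kle P 0 fun h hh => by
    simp only [hP, Finset.mem_filter, Finset.mem_univ, true_and, zero_add]
    exact ⟨hh.1, h₂ _ hx₂ _ hh.2⟩
  have kQ : k ≤ Q.card := kle Q 0 fun h hh => by
    simp only [hQ, Finset.mem_filter, Finset.mem_univ, true_and, zero_add]
    exact ⟨hh.2, n₁ _ hx₁ _ hh.1⟩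
  have kP' : P'.card = 0 ∨ k ≤ P'.card := by
    rcases Finset.eq_empty_or_nonempty P' with h | ⟨a, ha⟩
    · left; simp [h]
    · right
      simp only [hP', Finset.mem_filter, Finset.mem_univ, true_and] at ha
      refine kle P' a fun h hh => ?_
      simp only [hP', Finset.mem_filter, Finset.mem_univ, true_and]
      exact ⟨H₁.add_mem ha.1 hh.1, by rw [← add_assoc]; exact n₂ _ ha.2 _ hh.2⟩
  have kQ' : Q'.card = 0 ∨ k ≤ Q'.card := by
    rcases Finset.eq_empty_or_nonempty Q' with h | ⟨a, ha⟩
    · left; simp [h]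
    · right
      simp only [hQ', Finset.mem_filter, Finset.mem_univ, true_and] at ha
      refine kle Q' a fun h hh => ?_
      simp only [hQ', Finset.mem_filter, Finset.mem_univ, true_and]
      exact ⟨H₂.add_mem ha.1 hh.2, by rw [← add_assoc]; exact h₁ _ ha.2 _ hh.1⟩
  have c₁ : P.card * Q.card ≤ k * (C₂ \ C₁).card := by
    refine card_mul_card_le_of_add_mem H₁ H₂ P Q _ x ?_ ?_ ?_
    · intro a ha; simp [hP] at ha; exact ha.1
    · intro a ha; simp [hQ] at ha; exact ha.1
    · intro a ha b hb
      simp only [hP, hQ, Finset.mem_filter, Finset.mem_univ, true_and] at ha hb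
      rw [Finset.mem_sdiff]
      exact ⟨h₂ _ ha.2 _ hb.1, by rw [add_right_comm]; exact n₁ _ hb.2 _ ha.1⟩
  have c₂ : P'.card * Q'.card ≤ k * (C₁ \ C₂).card := by
    refine card_mul_card_le_of_add_mem H₁ H₂ P' Q' _ x ?_ ?_ ?_
    · intro a ha; simp [hP'] at ha; exact ha.1
    · intro a ha; simp [hQ'] at ha; exact ha.1
    · intro a ha b hb
      simp only [hP', hQ', Finset.mem_filter, Finset.mem_univ, true_and] at ha hb
      rw [Finset.mem_sdiff]
      exact ⟨by rw [add_right_comm]; exact h₁ _ hb.2 _ ha.1, n₂ _ ha.2 _ hb.1⟩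
  have kpos : 0 < k := Nat.card_pos
  generalize P.card = p at *
  generalize P'.card = p' at *
  generalize Q.card = q at *
  generalize Q'.card = q' at *
  generalize (C₂ \ C₁).card = X at *
  generalize (C₁ \ C₂).card = Y at *
  have mulbound : ∀ a b Z : ℕ, k ≤ a → k ≤ b → a * b ≤ k * Z → a + b ≤ Z + k := by
    intro a b Z ha hb h
    obtain ⟨a, rfl⟩ := Nat.exists_eq_add_of_le ha
    obtain ⟨b, rfl⟩ := Nat.exists_eq_add_of_le hb
    have : k * (k + a + b) ≤ k * Z := by nlinarith [Nat.zero_le (a * b)]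
    have := Nat.le_of_mul_le_mul_left this kpos
    omega
  have m₁ := mulbound _ _ _ kP kQ c₁
  rcases kP' with h | h
  · omega
  · rcases kQ' with h' | h'
    · omega
    · have m₂ := mulbound _ _ _ h h' c₂
      omega

lemma PeriodicBound.union {s : ℕ} {C₁ C₂ : Finset G}
    (hC₁ : PeriodicBound s C₁) (hC₂ : PeriodicBound s C₂) : PeriodicBound s (C₁ ∪ C₂) := by
  classical
  by_cases s₁ : C₁ ⊆ C₂
  · rwa [Finset.union_eq_right.2 s₁]
  by_cases s₂ : C₂ ⊆ C₁
  · rwa [Finset.union_eq_left.2 s₂]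
  obtain ⟨H₁, h₁, b₁⟩ := hC₁
  obtain ⟨H₂, h₂, b₂⟩ := hC₂
  obtain ⟨x₁, hx₁, hx₁'⟩ := Finset.not_subset.1 s₁
  obtain ⟨x₂, hx₂, hx₂'⟩ := Finset.not_subset.1 s₂
  refine ⟨H₁ ⊓ H₂, ?_, ?_⟩
  · intro c hc h hh
    rw [Finset.mem_union] at hc ⊢
    exact hc.imp (fun hc => h₁ _ hc _ hh.1) (fun hc => h₂ _ hc _ hh.2)
  · have e₁ : (C₁ ∪ C₂).card = C₁.card + (C₂ \ C₁).card := by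
      rw [← Finset.card_union_of_disjoint Finset.disjoint_sdiff, Finset.union_sdiff_self_eq_union]
    have e₂ : (C₁ ∪ C₂).card = C₂.card + (C₁ \ C₂).card := by
      rw [← Finset.card_union_of_disjoint Finset.disjoint_sdiff, Finset.union_sdiff_self_eq_union,
        Finset.union_comm]
    by_contra! hlt
    have hX : (C₂ \ C₁).card + Nat.card (H₁ ⊓ H₂ : AddSubgroup G) < Nat.card H₁ := by omega
    have hY : (C₁ \ C₂).card + Nat.card (H₁ ⊓ H₂ : AddSubgroup G) < Nat.card H₂ := by omega
    have g₁ := grid_count h₁ h₂ hx₂ hx₂' hX hY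
    have g₂ := grid_count h₂ h₁ hx₁ hx₁' (by rwa [inf_comm]) (by rwa [inf_comm])
    omega

lemma exists_periodicBound_mem (m : ℕ) : ∀ (A B : Finset G), B.card = m → ∀ a ∈ A, ∀ b ∈ B,
    ∃ C ⊆ A + B, a + b ∈ C ∧ PeriodicBound (A.card + B.card) C := by
  classical
  induction m using Nat.strong_induction_on with
  | _ m ih =>
    intro A B hm a ha b hb
    by_cases hstab : ∀ e ∈ A, ∀ y ∈ B, e + (y - b) ∈ A
    · refine ⟨b +ᵥ A, ?_, ?_, AddAction.stabilizer G A, ?_, ?_⟩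
      · intro z hz
        obtain ⟨y, hy, rfl⟩ := Finset.mem_vadd_finset.1 hz
        rw [vadd_eq_add, add_comm b y]
        exact Finset.add_mem_add hy hb
      · rw [add_comm]
        exact Finset.vadd_mem_vadd_finset ha
      · intro c hc h hh
        rw [AddAction.mem_stabilizer_iff] at hh
        rw [← hh, vadd_vadd, add_comm b h, ← vadd_vadd, add_comm c h]
        exact Finset.vadd_mem_vadd_finset hc
      · rw [Finset.card_vadd_finset, AddSubgroup.natCard_eq_card_filter]
        refine Nat.add_le_add_left (Finset.card_le_card_of_injOn (fun y => y - b) ?_ ?_) _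
        · intro y hy
          have : (y - b) +ᵥ A = A := by
            refine Finset.eq_of_subset_of_card_le ?_ (by rw [Finset.card_vadd_finset])
            intro z hz
            obtain ⟨e, he, rfl⟩ := Finset.mem_vadd_finset.1 hz
            rw [vadd_eq_add, add_comm]
            exact hstab e he y hy
          simpa using this
        · intro y _ y' _ e
          simpa using e
    · push Not at hstab
      obtain ⟨e, he, y, hy, hy'⟩ := hstab
      set D : Finset G := (e - b) +ᵥ B with hD
      set B' : Finset G := (b - e) +ᵥ (A ∩ D) with hB'
      have hB'mem : ∀ z, z ∈ B' ↔ z ∈ B ∧ e + (z - b) ∈ A := by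
        intro z
        rw [hB', ← Finset.neg_vadd_mem_iff, Finset.mem_inter, hD,
          ← Finset.neg_vadd_mem_iff, and_comm, vadd_vadd, vadd_eq_add, vadd_eq_add]
        have e1 : -(e - b) + -(b - e) + z = z := by abel
        have e2 : -(b - e) + z = e + (z - b) := by abel
        rw [e1, e2]
      have hsub : B' ⊂ B := by
        refine Finset.ssubset_iff_subset_ne.2 ⟨fun z hz => ((hB'mem z).1 hz).1, ?_⟩
        intro h
        rw [← h] at hy
        exact hy' ((hB'mem y).1 hy).2
      have hcard : (A ∪ D).card + B'.card = A.card + B.card := by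
        rw [hB', Finset.card_vadd_finset, Finset.card_union_add_card_inter, hD,
          Finset.card_vadd_finset]
      obtain ⟨C, hC, hmem, hper⟩ := ih B'.card (hm ▸ Finset.card_lt_card hsub) (A ∪ D) B' rfl a
        (Finset.mem_union_left _ ha) b ((hB'mem b).2 ⟨hb, by simpa using he⟩)
      refine ⟨C, hC.trans ?_, hmem, hcard ▸ hper⟩
      intro z hz
      obtain ⟨u, hu, w, hw, rfl⟩ := Finset.mem_add.1 hz
      rw [hB'mem] at hw
      rcases Finset.mem_union.1 hu with hu | hu
      · exact Finset.add_mem_add hu hw.1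
      · obtain ⟨t, ht, rfl⟩ := Finset.mem_vadd_finset.1 hu
        have : ((e - b) +ᵥ t) + w = e + (w - b) + t := by rw [vadd_eq_add]; abel
        rw [this]
        exact Finset.add_mem_add hw.2 ht

/-- **Kneser's addition theorem**, in a form bounding `|A + B|` by some period of `A + B`. -/
theorem kneser_periodicBound {A B : Finset G} (hA : A.Nonempty) (hB : B.Nonempty) :
    PeriodicBound (A.card + B.card) (A + B) := by
  classical
  have key : ∀ S : Finset G, S.Nonempty → S ⊆ A + B →
      ∃ C, S ⊆ C ∧ C ⊆ A + B ∧ PeriodicBound (A.card + B.card) C := by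
    intro S hS
    induction hS using Finset.Nonempty.cons_induction with
    | singleton x =>
      intro hx
      obtain ⟨a, ha, b, hb, rfl⟩ := Finset.mem_add.1 (Finset.singleton_subset_iff.1 hx)
      obtain ⟨C, hC, hm, hp⟩ := exists_periodicBound_mem _ A B rfl a ha b hb
      exact ⟨C, Finset.singleton_subset_iff.2 hm, hC, hp⟩
    | cons x S hx _ ih =>
      intro hsub
      rw [Finset.cons_subset] at hsub
      obtain ⟨C, hSC, hC, hp⟩ := ih hsub.2
      obtain ⟨a, ha, b, hb, rfl⟩ := Finset.mem_add.1 hsub.1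
      obtain ⟨C', hC', hm, hp'⟩ := exists_periodicBound_mem _ A B rfl a ha b hb
      refine ⟨C ∪ C', ?_, Finset.union_subset hC hC', hp.union hp'⟩
      rw [Finset.cons_subset]
      exact ⟨Finset.mem_union_right _ hm, hSC.trans Finset.subset_union_left⟩
  obtain ⟨C, h₁, h₂, hp⟩ := key (A + B) (hA.add hB) subset_rfl
  rwa [h₁.antisymm h₂]

end Kneser

section Characteristic

lemma fact_prime_five : Fact (Nat.Prime 5) := ⟨by norm_num⟩

attribute [local instance] fact_prime_five

lemma card_mul_card_fiber {V X : Type*} [AddCommGroup V] [Fintype V] [AddCommGroup X]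
    [Fintype X] [DecidableEq X] {f : V →+ X} (hf : Function.Surjective f) (x : X) :
    Fintype.card X * Finset.card {v : V | f v = x} = Fintype.card V := by
  have h : ∀ y ∈ (Finset.univ : Finset X),
      Finset.card {v : V | f v = y} = Finset.card {v : V | f v = x} := by
    intro y _
    exact AddMonoidHom.card_fiber_eq_of_mem_range f (hf y) (hf x)
  have := Finset.card_eq_sum_card_fiberwise (s := (Finset.univ : Finset V))
    (t := (Finset.univ : Finset X)) (f := f) (fun _ _ => Finset.mem_coe.2 (Finset.mem_univ _))
  rw [Finset.sum_congr rfl h, Finset.sum_const, Finset.card_univ, Finset.card_univ,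
    smul_eq_mul] at this
  exact this.symm

/-- The number of elements of `A` whose value under `f` is `x`. -/
def fiberCount {V X : Type*} [DecidableEq X] (A : Finset V) (f : V → X) (x : X) : ℕ :=
  (A.filter (f · = x)).card

lemma fiberCount_pos {V X : Type*} [DecidableEq X] {A : Finset V} {f : V → X} {x : X} :
    0 < fiberCount A f x ↔ ∃ a ∈ A, f a = x := by
  simp [fiberCount, Finset.card_pos, Finset.Nonempty]

section Fibers

variable {V X : Type*} [AddCommGroup V] [DecidableEq V] [AddCommGroup X] [DecidableEq X]
  {A : Finset V} {f : V →+ X} {N : ℕ}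

lemma card_fiber_add_le [Fintype V] (hA : ∀ a ∈ A, ∀ b ∈ A, a + b ∉ A)
    (hN : ∀ x, Finset.card {v : V | f v = x} ≤ N) {a : V} (ha : a ∈ A) (q : X) :
    (A.filter (f · = q)).card + (A.filter (f · = q + f a)).card ≤ N := by
  rw [← Finset.card_image_of_injective (A.filter (f · = q)) (add_left_injective a),
    ← Finset.card_union_of_disjoint]
  · refine (Finset.card_le_card ?_).trans (hN (q + f a))
    intro v hv
    simp only [Finset.mem_union, Finset.mem_image, Finset.mem_filter, Finset.mem_univ,
      true_and] at hv ⊢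
    rcases hv with ⟨b, hb, rfl⟩ | hv
    · rw [map_add, hb.2]
    · exact hv.2
  · rw [Finset.disjoint_left]
    intro v hv hv'
    simp only [Finset.mem_image, Finset.mem_filter] at hv hv'
    obtain ⟨b, hb, rfl⟩ := hv
    exact hA b hb.1 a ha hv'.1

lemma card_fiber_sub_le [Fintype V] (hA : ∀ a ∈ A, ∀ b ∈ A, a + b ∉ A)
    (hN : ∀ x, Finset.card {v : V | f v = x} ≤ N) {a : V} (ha : a ∈ A) (q : X) :
    (A.filter (f · = q)).card + (A.filter (f · = f a - q)).card ≤ N := by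
  rw [← Finset.card_image_of_injective (A.filter (f · = q)) (sub_right_injective (b := a)),
    ← Finset.card_union_of_disjoint]
  · refine (Finset.card_le_card ?_).trans (hN (f a - q))
    intro v hv
    simp only [Finset.mem_union, Finset.mem_image, Finset.mem_filter, Finset.mem_univ,
      true_and] at hv ⊢
    rcases hv with ⟨b, hb, rfl⟩ | hv
    · rw [map_sub, hb.2]
    · exact hv.2
  · rw [Finset.disjoint_left]
    intro v hv hv'
    simp only [Finset.mem_image, Finset.mem_filter] at hv hv'
    obtain ⟨b, hb, rfl⟩ := hv
    exact hA _ hv'.1 b hb.1 (by simpa using ha)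

end Fibers

section Rows

variable {V : Type*} [AddCommGroup V] [Module (ZMod 5) V]

/-- `A` lies in the two cosets `{2, 3}` of the kernel of some linear functional. -/
def IsNormal (A : Finset V) : Prop :=
  ∃ l : V →ₗ[ZMod 5] ZMod 5, l ≠ 0 ∧ ∀ a ∈ A, l a = 2 ∨ l a = 3

lemma ZMod.sum_five {M : Type*} [AddCommMonoid M] (f : ZMod 5 → M) :
    ∑ c, f c = f 0 + f 1 + f 2 + f 3 + f 4 :=
  Fin.sum_univ_five f

lemma ZMod.five_cases (x : ZMod 5) : x = 0 ∨ x = 1 ∨ x = 2 ∨ x = 3 ∨ x = 4 := by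
  revert x; decide

variable {A : Finset V} {M : ℕ}

section Bounds

variable [Fintype V] {X : Type*} [AddCommGroup X] [Module (ZMod 5) X] [Fintype X] [DecidableEq X]
  {f : V →ₗ[ZMod 5] X} {N : ℕ}

lemma card_fiber_eq (hV : Fintype.card V = Fintype.card X * N) (hf : Function.Surjective f)
    (x : X) : Finset.card {v : V | f v = x} = N := by
  have := card_mul_card_fiber (f := f.toAddMonoidHom) hf x
  rw [hV] at this
  exact Nat.eq_of_mul_eq_mul_left Fintype.card_pos this

lemma fiberCount_add_le (hA : ∀ a ∈ A, ∀ b ∈ A, a + b ∉ A)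
    (hV : Fintype.card V = Fintype.card X * N) (hf : Function.Surjective f) {p : X}
    (hp : 0 < fiberCount A f p) (q : X) :
    fiberCount A f q + fiberCount A f (q + p) ≤ N := by
  classical
  obtain ⟨a, ha, rfl⟩ := fiberCount_pos.1 hp
  exact card_fiber_add_le (f := f.toAddMonoidHom) hA (fun x => (card_fiber_eq hV hf x).le) ha q

lemma fiberCount_sub_le (hA : ∀ a ∈ A, ∀ b ∈ A, a + b ∉ A)
    (hV : Fintype.card V = Fintype.card X * N) (hf : Function.Surjective f) {p : X}
    (hp : 0 < fiberCount A f p) (q : X) :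
    fiberCount A f q + fiberCount A f (p - q) ≤ N := by
  classical
  obtain ⟨a, ha, rfl⟩ := fiberCount_pos.1 hp
  exact card_fiber_sub_le (f := f.toAddMonoidHom) hA (fun x => (card_fiber_eq hV hf x).le) ha q

lemma fiberCount_le (A : Finset V) (hV : Fintype.card V = Fintype.card X * N)
    (hf : Function.Surjective f) (q : X) : fiberCount A f q ≤ N := by
  rw [← card_fiber_eq hV hf q]
  exact Finset.card_le_card (Finset.filter_subset_filter _ (Finset.subset_univ A))

end Bounds

lemma isNormal_of_card [Fintype V] (hA : ∀ a ∈ A, ∀ b ∈ A, a + b ∉ A)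
    (hV : Fintype.card V = Fintype.card (ZMod 5) * (5 * M))
    {l : V →ₗ[ZMod 5] ZMod 5} (hl : Function.Surjective l)
    (h : 5 * M < fiberCount A l 2 + fiberCount A l 3) : IsNormal A := by
  refine ⟨l, ?_, ?_⟩
  · rintro rfl
    obtain ⟨v, hv⟩ := hl 1
    exact zero_ne_one hv
  · intro a ha
    have hp : 0 < fiberCount A l (l a) := fiberCount_pos.2 ⟨a, ha, rfl⟩
    have h₂ := fiberCount_add_le hA hV hl hp 2
    have h₃ := fiberCount_add_le hA hV hl hp 3
    rcases ZMod.five_cases (l a) with e | e | e | e | e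
    · rw [e] at h₂ h₃
      simp only [add_zero] at h₂ h₃
      omega
    · rw [e, show (2 + 1 : ZMod 5) = 3 by decide] at h₂
      omega
    · exact Or.inl e
    · exact Or.inr e
    · rw [e, show (3 + 4 : ZMod 5) = 2 by decide] at h₃
      omega

/-- If many elements of `A` lie in rows of `ψ`, and `A` restricted to these rows lies in
`{2, 3}` for some functional, then `A` is normal. -/
lemma isNormal_of_rows [Fintype V] (hA : ∀ a ∈ A, ∀ b ∈ A, a + b ∉ A)
    (hV : Fintype.card V = Fintype.card (ZMod 5) * (5 * M))
    (ψ l : V →ₗ[ZMod 5] ZMod 5) {i j k : ZMod 5}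
    (hij : 5 * M < fiberCount A ψ i + fiberCount A ψ j + fiberCount A ψ k)
    (hi : i ≠ j) (hj : i ≠ k) (hk : j ≠ k)
    (hl : ∀ a ∈ A, ψ a = i ∨ ψ a = j ∨ ψ a = k → l a = 2 ∨ l a = 3) : IsNormal A := by
  classical
  have hsum : fiberCount A ψ i + fiberCount A ψ j + fiberCount A ψ k ≤
      fiberCount A l 2 + fiberCount A l 3 := by
    unfold fiberCount
    rw [← Finset.card_union_of_disjoint, ← Finset.card_union_of_disjoint,
      ← Finset.card_union_of_disjoint]
    · refine Finset.card_le_card fun a ha => ?_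
      simp only [Finset.mem_union, Finset.mem_filter] at ha ⊢
      have h1 : a ∈ A := by tauto
      have h2 := hl a h1 (by tauto)
      tauto
    · exact Finset.disjoint_filter.2 fun a _ h h' => absurd (h.symm.trans h') (by decide)
    · rw [Finset.disjoint_union_left]
      exact ⟨Finset.disjoint_filter.2 fun a _ h h' => hj (h.symm.trans h'),
        Finset.disjoint_filter.2 fun a _ h h' => hk (h.symm.trans h')⟩
    · exact Finset.disjoint_filter.2 fun a _ h h' => hi (h.symm.trans h')
  refine isNormal_of_card hA hV (LinearMap.surjective ?_) (hij.trans_le hsum)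
  rintro rfl
  have : ∀ x : ZMod 5, x ≠ 0 → fiberCount A (0 : V →ₗ[ZMod 5] ZMod 5) x = 0 := by
    intro x hx
    by_contra h
    obtain ⟨a, _, h⟩ := fiberCount_pos.1 (Nat.pos_of_ne_zero h)
    exact hx (by simpa using h.symm)
  rw [this 2 (by decide), this 3 (by decide)] at hsum
  omega

/-- The number of elements of `A` in each cell cut out by the pair of functionals `ψ`, `χ`. -/
def cellCount (A : Finset V) (ψ χ : V →ₗ[ZMod 5] ZMod 5) : ZMod 5 × ZMod 5 → ℕ :=
  fiberCount A (ψ.prod χ)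

/-- The values of `χ` on the row `ψ = r` of `A`. -/
def rowSupport (A : Finset V) (ψ χ : V →ₗ[ZMod 5] ZMod 5) (r : ZMod 5) : Finset (ZMod 5) :=
  {c | 0 < cellCount A ψ χ (r, c)}

lemma mem_rowSupport {ψ χ : V →ₗ[ZMod 5] ZMod 5} {r c : ZMod 5} :
    c ∈ rowSupport A ψ χ r ↔ ∃ a ∈ A, ψ a = r ∧ χ a = c := by
  simp [rowSupport, cellCount, fiberCount_pos]

lemma cellCount_pos {ψ χ : V →ₗ[ZMod 5] ZMod 5} {r c : ZMod 5} :
    0 < cellCount A ψ χ (r, c) ↔ c ∈ rowSupport A ψ χ r := by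
  simp [rowSupport]

lemma cellCount_eq_zero {ψ χ : V →ₗ[ZMod 5] ZMod 5} {r c : ZMod 5}
    (h : c ∉ rowSupport A ψ χ r) : cellCount A ψ χ (r, c) = 0 := by
  rw [← cellCount_pos] at h
  omega

lemma rowSupport_nonempty {ψ χ : V →ₗ[ZMod 5] ZMod 5} {r : ZMod 5} :
    (rowSupport A ψ χ r).Nonempty ↔ 0 < fiberCount A ψ r := by
  simp only [Finset.Nonempty, mem_rowSupport, fiberCount_pos]
  constructor
  · rintro ⟨c, a, ha, h, _⟩
    exact ⟨a, ha, h⟩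
  · rintro ⟨a, ha, h⟩
    exact ⟨χ a, a, ha, h, rfl⟩

lemma fiberCount_eq_sum (A : Finset V) (ψ χ : V →ₗ[ZMod 5] ZMod 5) (r : ZMod 5) :
    fiberCount A ψ r = ∑ c, cellCount A ψ χ (r, c) := by
  classical
  unfold fiberCount cellCount fiberCount
  rw [Finset.card_eq_sum_card_fiberwise (f := χ) (t := Finset.univ)
    (fun _ _ => Finset.mem_coe.2 (Finset.mem_univ _))]
  refine Finset.sum_congr rfl fun c _ => ?_
  rw [Finset.filter_filter]
  congr 1
  ext a
  simp [Prod.ext_iff]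

/-- Bounds satisfied by the cell counts of a sum-free set. -/
structure CellBound (w : ZMod 5 × ZMod 5 → ℕ) (M : ℕ) : Prop where
  le : ∀ p, w p ≤ M
  add : ∀ p, 0 < w p → ∀ q, w q + w (q + p) ≤ M
  sub : ∀ p, 0 < w p → ∀ q, w q + w (p - q) ≤ M

lemma cellBound [Fintype V] (hA : ∀ a ∈ A, ∀ b ∈ A, a + b ∉ A)
    (hV : Fintype.card V = Fintype.card (ZMod 5) * (5 * M)) {ψ χ : V →ₗ[ZMod 5] ZMod 5}
    (hs : Function.Surjective (ψ.prod χ)) : CellBound (cellCount A ψ χ) M := by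
  have hV' : Fintype.card V = Fintype.card (ZMod 5 × ZMod 5) * M := by
    rw [hV, Fintype.card_prod, ZMod.card]
    ring
  exact ⟨fun p => fiberCount_le A hV' hs p, fun p hp q => fiberCount_add_le hA hV' hs hp q,
    fun p hp q => fiberCount_sub_le hA hV' hs hp q⟩

lemma fiberCount_le_card_rowSupport {ψ χ : V →ₗ[ZMod 5] ZMod 5}
    (hw : CellBound (cellCount A ψ χ) M) (r : ZMod 5) :
    fiberCount A ψ r ≤ (rowSupport A ψ χ r).card * M := by
  rw [fiberCount_eq_sum A ψ χ, ← smul_eq_mul]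
  rw [← Finset.sum_subset (Finset.subset_univ (rowSupport A ψ χ r))]
  · exact Finset.sum_le_card_nsmul _ _ _ fun c _ => hw.le _
  · intro c _ hc
    exact cellCount_eq_zero hc

/-- Changing `χ` to an affine combination of `χ` and `ψ`. -/
lemma exists_shear {ψ χ : V →ₗ[ZMod 5] ZMod 5} (hs : Function.Surjective (ψ.prod χ))
    {d : ZMod 5} (hd : d ≠ 0) (e : ZMod 5) :
    ∃ χ' : V →ₗ[ZMod 5] ZMod 5, Function.Surjective (ψ.prod χ') ∧
      ∀ r x, x ∈ rowSupport A ψ χ' r ↔ d * x + e * r ∈ rowSupport A ψ χ r := by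
  refine ⟨d⁻¹ • (χ - e • ψ), ?_, ?_⟩
  · rintro ⟨r, x⟩
    obtain ⟨v, hv⟩ := hs (r, d * x + e * r)
    simp only [LinearMap.prod_apply, Function.prod_apply, Prod.mk.injEq] at hv
    refine ⟨v, ?_⟩
    simp [hv.1, hv.2, hd]
  · intro r x
    simp only [mem_rowSupport]
    refine exists_congr fun a => and_congr_right fun _ => and_congr_right fun h => ?_
    simp only [LinearMap.smul_apply, LinearMap.sub_apply, smul_eq_mul, h]
    rw [inv_mul_eq_iff_eq_mul₀ hd, sub_eq_iff_eq_add]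

/-- A row with exactly two nonempty cells can be moved to the columns `0`, `1`. -/
lemma exists_shear_of_card_eq_two {ψ χ : V →ₗ[ZMod 5] ZMod 5}
    (hs : Function.Surjective (ψ.prod χ)) {k : ZMod 5} (hk : k ≠ 0)
    (h2 : (rowSupport A ψ χ k).card = 2) :
    ∃ χ' : V →ₗ[ZMod 5] ZMod 5, Function.Surjective (ψ.prod χ') ∧
      (∀ x, x ∈ rowSupport A ψ χ' k ↔ x = 0 ∨ x = 1) ∧
      ∀ i j l, i + j = l → (∀ x ∈ rowSupport A ψ χ i, ∀ y ∈ rowSupport A ψ χ j,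
        x + y ∉ rowSupport A ψ χ l) → ∀ x ∈ rowSupport A ψ χ' i, ∀ y ∈ rowSupport A ψ χ' j,
        x + y ∉ rowSupport A ψ χ' l := by
  obtain ⟨y, y', hne, hS⟩ := Finset.card_eq_two.1 h2
  have hd : y' - y ≠ 0 := sub_ne_zero.2 hne.symm
  obtain ⟨χ', hs', h⟩ := exists_shear (A := A) hs hd (y / k)
  refine ⟨χ', hs', ?_, ?_⟩
  · intro x
    rw [h, hS, Finset.mem_insert, Finset.mem_singleton, div_mul_cancel₀ _ hk]
    refine or_congr ?_ ?_
    · rw [add_eq_right, mul_eq_zero_iff_left hd]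
    · rw [← eq_sub_iff_add_eq, mul_eq_left₀ hd]
  · intro i j l hl H a ha b hb hab
    rw [h] at ha hb hab
    refine H _ ha _ hb ?_
    convert hab using 1
    rw [← hl]
    ring

/-- If the rows `i`, `j`, `i + j` are large then, by Kneser's theorem, the sum of the rows
`i` and `j` is periodic and hence avoids the row `i + j` at the level of cells. -/
lemma exists_rowSupport_add_notMem [Fintype V] (hA : ∀ a ∈ A, ∀ b ∈ A, a + b ∉ A)
    {m : ℕ} (hM : M = 5 ^ m) (hV : Fintype.card V = Fintype.card (ZMod 5) * (5 * M))
    {ψ : V →ₗ[ZMod 5] ZMod 5} (hψ : Function.Surjective ψ) {i j k : ZMod 5} (hk : i + j = k)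
    (hi : 0 < fiberCount A ψ i) (hj : 0 < fiberCount A ψ j) (hk0 : 0 < fiberCount A ψ k)
    (hbig : 26 * M < 5 * (fiberCount A ψ i + fiberCount A ψ j + fiberCount A ψ k)) :
    ∃ χ : V →ₗ[ZMod 5] ZMod 5, Function.Surjective (ψ.prod χ) ∧
      ∀ x ∈ rowSupport A ψ χ i, ∀ y ∈ rowSupport A ψ χ j, x + y ∉ rowSupport A ψ χ k := by
  classical
  set B := A.filter (ψ · = i) with hB
  set C := A.filter (ψ · = j) with hC
  set D := A.filter (ψ · = k) with hD
  obtain ⟨H, hH, hcard⟩ := kneser_periodicBound (A := B) (B := C) (Finset.card_pos.1 hi)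
    (Finset.card_pos.1 hj)
  have hrow : ∀ c ∈ B + C, ψ c = k := by
    intro z hz
    obtain ⟨b, hb, c, hc, rfl⟩ := Finset.mem_add.1 hz
    rw [Finset.mem_filter] at hb hc
    rw [map_add, hb.2, hc.2, hk]
  have hdisj : Disjoint (B + C) D := by
    rw [Finset.disjoint_left]
    intro z hz hz'
    obtain ⟨b, hb, c, hc, rfl⟩ := Finset.mem_add.1 hz
    rw [Finset.mem_filter] at hb hc hz'
    exact hA _ hb.1 _ hc.1 hz'.1
  have hle : (B + C).card + D.card ≤ 5 * M := by
    rw [← card_fiber_eq hV hψ k, ← Finset.card_union_of_disjoint hdisj]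
    refine Finset.card_le_card fun z hz => ?_
    rw [Finset.mem_filter]
    refine ⟨Finset.mem_univ _, ?_⟩
    rcases Finset.mem_union.1 hz with hz | hz
    · exact hrow z hz
    · exact (Finset.mem_filter.1 hz).2
  have hbig' : 26 * M < 5 * (B.card + C.card + D.card) := hbig
  obtain ⟨c₀, hc₀⟩ : (B + C).Nonempty := (Finset.card_pos.1 hi).add (Finset.card_pos.1 hj)
  obtain ⟨d₀, hd₀⟩ : D.Nonempty := Finset.card_pos.1 hk0
  have hHψ : ∀ h ∈ H, ψ h = 0 := by
    intro h hh
    have := hrow _ (hH _ hc₀ h hh)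
    rw [map_add, hrow _ hc₀] at this
    simpa using this
  have hu : ψ (d₀ - c₀) = 0 := by
    rw [map_sub, hrow _ hc₀, (Finset.mem_filter.1 hd₀).2, sub_self]
  have huH : d₀ - c₀ ∉ H := fun hm => by
    have := hH _ hc₀ _ hm
    rw [add_sub_cancel] at this
    exact Finset.disjoint_left.1 hdisj this hd₀
  have hHM : M ≤ Nat.card H := by
    have hdvd : Nat.card H ∣ 5 ^ (m + 2) := by
      have := AddSubgroup.card_addSubgroup_dvd_card H
      rw [Nat.card_eq_fintype_card (α := V), hV, hM, ZMod.card] at this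
      convert this using 1
      ring
    obtain ⟨t, _, ht⟩ := (Nat.dvd_prime_pow Nat.prime_five).1 hdvd
    have : 5 ^ m < 5 ^ (t + 1) := by
      rw [pow_succ, ← ht, ← hM]
      omega
    have := (Nat.pow_lt_pow_iff_right (by norm_num)).1 this
    rw [hM, ht]
    exact Nat.pow_le_pow_right (by norm_num) (by omega)
  obtain ⟨χ, hχu, hχ⟩ := Submodule.exists_le_ker_of_notMem
    (p := AddSubgroup.toZModSubmodule 5 H) (v := d₀ - c₀) (by simpa using huH)
  have hHχ : ∀ h ∈ H, χ h = 0 := fun h hh => hχ (by simpa using hh)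
  obtain ⟨v, hv⟩ := hψ 1
  have hs : Function.Surjective (ψ.prod χ) := by
    rintro ⟨r, x⟩
    refine ⟨r • v + ((x - r * χ v) / χ (d₀ - c₀)) • (d₀ - c₀), ?_⟩
    refine Prod.ext ?_ ?_
    · change ψ _ = r
      simp [hu, hv]
    · change χ _ = x
      rw [map_add, map_smul, map_smul, smul_eq_mul, smul_eq_mul, div_mul_cancel₀ _ hχu]
      ring
  refine ⟨χ, hs, ?_⟩
  have hker : ∀ z, ψ z = 0 → χ z = 0 → z ∈ H := by
    have hV' : Fintype.card V = Fintype.card (ZMod 5 × ZMod 5) * M := by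
      rw [hV, Fintype.card_prod, ZMod.card]
      ring
    have hc := card_fiber_eq hV' hs 0
    rw [AddSubgroup.natCard_eq_card_filter] at hHM
    have hsub : Finset.filter (· ∈ H) Finset.univ ⊆
        Finset.filter (fun v : V => ψ.prod χ v = 0) Finset.univ := by
      intro h hh
      simp only [Finset.mem_filter, Finset.mem_univ, true_and] at hh ⊢
      ext
      · exact hHψ h hh
      · exact hHχ h hh
    have heq := Finset.eq_of_subset_of_card_le hsub (by omega)
    intro z h1 h2
    have : z ∈ Finset.filter (fun v : V => ψ.prod χ v = 0) Finset.univ := by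
      simp only [Finset.mem_filter, Finset.mem_univ, true_and]
      ext
      · exact h1
      · exact h2
    rw [← heq] at this
    simpa using this
  intro x hx y hy hxy
  obtain ⟨a, ha, h1, h2⟩ := mem_rowSupport.1 hx
  obtain ⟨b, hb, h3, h4⟩ := mem_rowSupport.1 hy
  obtain ⟨d, hd, h5, h6⟩ := mem_rowSupport.1 hxy
  have hab : a + b ∈ B + C :=
    Finset.add_mem_add (Finset.mem_filter.2 ⟨ha, h1⟩) (Finset.mem_filter.2 ⟨hb, h3⟩)
  have hz : d - (a + b) ∈ H := hker _ (by rw [map_sub, map_add, h1, h3, h5, hk, sub_self])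
    (by rw [map_sub, map_add, h2, h4, h6, sub_self])
  have := hH _ hab _ hz
  rw [add_sub_cancel] at this
  exact Finset.disjoint_left.1 hdisj this (Finset.mem_filter.2 ⟨hd, h5⟩)

lemma card_rowSupport_add_le {ψ χ : V →ₗ[ZMod 5] ZMod 5} {i j k : ZMod 5}
    (hi : (rowSupport A ψ χ i).Nonempty) (hj : (rowSupport A ψ χ j).Nonempty)
    (hk : (rowSupport A ψ χ k).Nonempty)
    (H : ∀ x ∈ rowSupport A ψ χ i, ∀ y ∈ rowSupport A ψ χ j, x + y ∉ rowSupport A ψ χ k) :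
    (rowSupport A ψ χ i).card + (rowSupport A ψ χ j).card + (rowSupport A ψ χ k).card ≤ 6 := by
  have h := ZMod.cauchy_davenport Nat.prime_five hi hj
  have hd : Disjoint (rowSupport A ψ χ i + rowSupport A ψ χ j) (rowSupport A ψ χ k) := by
    rw [Finset.disjoint_left]
    intro z hz
    obtain ⟨x, hx, y, hy, rfl⟩ := Finset.mem_add.1 hz
    exact H x hx y hy
  have hc := Finset.card_le_univ ((rowSupport A ψ χ i + rowSupport A ψ χ j) ∪ rowSupport A ψ χ k)
  rw [Finset.card_union_of_disjoint hd, ZMod.card] at hc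
  have := hk.card_pos
  omega

lemma fiberCount_add_add_le [Fintype V] (hA : ∀ a ∈ A, ∀ b ∈ A, a + b ∉ A)
    {m : ℕ} (hM : M = 5 ^ m) (hV : Fintype.card V = Fintype.card (ZMod 5) * (5 * M))
    {ψ : V →ₗ[ZMod 5] ZMod 5} (hψ : Function.Surjective ψ) {i j k : ZMod 5} (hk : i + j = k)
    (hi : 0 < fiberCount A ψ i) (hj : 0 < fiberCount A ψ j) (hk0 : 0 < fiberCount A ψ k) :
    fiberCount A ψ i + fiberCount A ψ j + fiberCount A ψ k ≤ 6 * M := by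
  by_contra! h
  obtain ⟨χ, hs, H⟩ := exists_rowSupport_add_notMem hA hM hV hψ hk hi hj hk0 (by omega)
  have hc := card_rowSupport_add_le (rowSupport_nonempty.2 hi) (rowSupport_nonempty.2 hj)
    (rowSupport_nonempty.2 hk0) H
  have hw := cellBound hA hV hs
  have h₁ := fiberCount_le_card_rowSupport hw i
  have h₂ := fiberCount_le_card_rowSupport hw j
  have h₃ := fiberCount_le_card_rowSupport hw k
  have := Nat.mul_le_mul_right M hc
  rw [add_mul, add_mul] at this
  omega

/-- When three distinct rows `i`, `j`, `k` have at most six nonempty cells but large total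
weight, then they have exactly six nonempty cells, and these form a sum-free set. -/
lemma sumFree_of_card_rowSupport {ψ χ : V →ₗ[ZMod 5] ZMod 5}
    (hw : CellBound (cellCount A ψ χ) M) {i j k : ZMod 5} (hij : i ≠ j) (hik : i ≠ k)
    (hjk : j ≠ k)
    (hbig : 26 * M < 5 * (fiberCount A ψ i + fiberCount A ψ j + fiberCount A ψ k))
    (h6 : (rowSupport A ψ χ i).card + (rowSupport A ψ χ j).card + (rowSupport A ψ χ k).card ≤ 6) :
    (rowSupport A ψ χ i).card + (rowSupport A ψ χ j).card + (rowSupport A ψ χ k).card = 6 ∧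
    ∀ r s t, r + s = t → (r = i ∨ r = j ∨ r = k) → (s = i ∨ s = j ∨ s = k) →
      (t = i ∨ t = j ∨ t = k) → ∀ x ∈ rowSupport A ψ χ r, ∀ y ∈ rowSupport A ψ χ s,
      x + y ∉ rowSupport A ψ χ t := by
  classical
  set w := cellCount A ψ χ with hwdef
  set F : Finset (ZMod 5 × ZMod 5) :=
    ((({i, j, k} : Finset (ZMod 5)) ×ˢ (Finset.univ : Finset (ZMod 5)))).filter (0 < w ·) with hF
  have hmem : ∀ r x, (r = i ∨ r = j ∨ r = k) → x ∈ rowSupport A ψ χ r → (r, x) ∈ F := by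
    intro r x hr hx
    simp only [hF, Finset.mem_filter, Finset.mem_product, Finset.mem_insert,
      Finset.mem_singleton, Finset.mem_univ, and_true]
    exact ⟨hr, cellCount_pos.2 hx⟩
  have hsum3 : ∀ g : ZMod 5 → ℕ, ∑ r ∈ ({i, j, k} : Finset (ZMod 5)), g r = g i + g j + g k := by
    intro g
    rw [Finset.sum_insert (by simp [hij, hik]), Finset.sum_insert (by simp [hjk]),
      Finset.sum_singleton, add_assoc]
  have hcard : F.card ≤ 6 := by
    rw [hF, Finset.card_filter, Finset.sum_product, hsum3]
    simp only [← Finset.card_filter]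
    exact h6
  have hFsum : ∑ p ∈ F, w p = fiberCount A ψ i + fiberCount A ψ j + fiberCount A ψ k := by
    rw [fiberCount_eq_sum A ψ χ, fiberCount_eq_sum A ψ χ, fiberCount_eq_sum A ψ χ,
      ← hsum3 (fun r => ∑ c, cellCount A ψ χ (r, c)),
      ← Finset.sum_product (f := fun p => cellCount A ψ χ p), hF, Finset.sum_filter]
    refine Finset.sum_congr rfl fun p _ => ?_
    split_ifs with h
    · rfl
    · rw [← hwdef]; omega
  have hM : 0 < M := by
    by_contra h
    have : ∑ p ∈ F, w p = 0 := Finset.sum_eq_zero fun p _ => by have := hw.le p; omega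
    omega
  have hpair : ∀ p ∈ F, ∀ q ∈ F, p ≠ q → M < w p + w q := by
    intro p hp q hq hpq
    have e1 := Finset.add_sum_erase F w hp
    have hq' : q ∈ F.erase p := Finset.mem_erase.2 ⟨hpq.symm, hq⟩
    have e2 := Finset.add_sum_erase _ w hq'
    have e3 : ∑ x ∈ (F.erase p).erase q, w x ≤ ((F.erase p).erase q).card • M :=
      Finset.sum_le_card_nsmul _ _ _ fun x _ => hw.le x
    rw [Finset.card_erase_of_mem hq', Finset.card_erase_of_mem hp, smul_eq_mul] at e3
    have e4 := Nat.mul_le_mul_right M (show F.card - 1 - 1 ≤ 4 by omega)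
    omega
  have hsf : ∀ p ∈ F, ∀ q ∈ F, p + q ∉ F := by
    intro p hp q hq hpq
    have pos : ∀ x ∈ F, 0 < w x := fun x hx => (Finset.mem_filter.1 hx).2
    by_cases h : p = q
    · subst h
      by_cases h0 : p = 0
      · subst h0
        have key : F ⊆ {0} := by
          intro q hq
          rw [Finset.mem_singleton]
          by_contra hne
          have h1 := hpair 0 hp q hq (Ne.symm hne)
          have h2 := hw.add 0 (pos _ hp) q
          have h3 := hw.add 0 (pos _ hp) 0
          simp only [add_zero] at h2 h3
          omega
        have h1 : ∑ p ∈ F, w p ≤ ∑ p ∈ ({0} : Finset (ZMod 5 × ZMod 5)), w p :=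
          Finset.sum_le_sum_of_subset key
        rw [Finset.sum_singleton] at h1
        have := hw.le 0
        omega
      · have h1 := hpair p hp (p + p) hpq (by simpa using h0)
        have h2 := hw.add p (pos _ hp) p
        omega
    · have h1 := hpair p hp q hq h
      have h2 := hw.sub (p + q) (pos _ hpq) p
      rw [add_sub_cancel_left] at h2
      omega
  constructor
  · refine le_antisymm h6 ?_
    by_contra! hlt
    have h₁ := fiberCount_le_card_rowSupport hw i
    have h₂ := fiberCount_le_card_rowSupport hw j
    have h₃ := fiberCount_le_card_rowSupport hw k
    have := Nat.mul_le_mul_right M (Nat.le_of_lt_succ hlt)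
    rw [add_mul, add_mul] at this
    omega
  · intro r s t hrst hr hs ht x hx y hy hxy
    have := hsf _ (hmem r x hr hx) _ (hmem s y hs hy)
    rw [Prod.mk_add_mk, hrst] at this
    exact this (hmem t _ ht hxy)

lemma two_mul_card_le_five {S : Finset (ZMod 5)} {x : ZMod 5} (h : ∀ y ∈ S, x + y ∉ S) :
    2 * S.card ≤ 5 := by
  have hd : Disjoint S (S.image (x + ·)) := by
    rw [Finset.disjoint_left]
    intro z hz hz'
    obtain ⟨y, hy, rfl⟩ := Finset.mem_image.1 hz'
    exact h y hy hz
  have := Finset.card_le_univ (S ∪ S.image (x + ·))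
  rw [Finset.card_union_of_disjoint hd, Finset.card_image_of_injective _ (add_right_injective x),
    ZMod.card] at this
  omega

lemma eq_pair_of_card {S : Finset (ZMod 5)} {u v : ZMod 5} (h2 : 2 ≤ S.card)
    (h : ∀ x ∈ S, x = u ∨ x = v) : u ∈ S ∧ v ∈ S := by
  have hsub : S ⊆ {u, v} := fun x hx => by simpa using h x hx
  have := Finset.eq_of_subset_of_card_le hsub (Finset.card_le_two.trans h2)
  rw [this]
  simp

/-- The rows `2`, `3`, `4`. -/
lemma isNormal_of_rows_two_three_four [Fintype V] (hA : ∀ a ∈ A, ∀ b ∈ A, a + b ∉ A)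
    {m : ℕ} (hM : M = 5 ^ m) (hV : Fintype.card V = Fintype.card (ZMod 5) * (5 * M))
    {ψ : V →ₗ[ZMod 5] ZMod 5} (hψ : Function.Surjective ψ)
    (hbig : 26 * M < 5 * (fiberCount A ψ 2 + fiberCount A ψ 3 + fiberCount A ψ 4)) :
    IsNormal A := by
  have hMpos : 0 < M := hM ▸ by positivity
  have b2 := fiberCount_le A hV hψ 2
  have b3 := fiberCount_le A hV hψ 3
  rcases Nat.eq_zero_or_pos (fiberCount A ψ 4) with h4 | h4
  · exact isNormal_of_card hA hV hψ (by omega)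
  have h43 : fiberCount A ψ 4 + fiberCount A ψ 3 ≤ 5 * M := fiberCount_add_le hA hV hψ h4 4
  have h2 : 0 < fiberCount A ψ 2 := by omega
  have h24 : fiberCount A ψ 2 + fiberCount A ψ 4 ≤ 5 * M := fiberCount_add_le hA hV hψ h2 2
  have h3 : 0 < fiberCount A ψ 3 := by omega
  obtain ⟨χ, hs, H⟩ := exists_rowSupport_add_notMem hA hM hV hψ (show (3 + 4 : ZMod 5) = 2 from rfl)
    h3 h4 h2 (by omega)
  have main : ∀ χ : V →ₗ[ZMod 5] ZMod 5, Function.Surjective (ψ.prod χ) →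
      (∀ x ∈ rowSupport A ψ χ 3, ∀ y ∈ rowSupport A ψ χ 4, x + y ∉ rowSupport A ψ χ 2) →
      ((rowSupport A ψ χ 2).card = 2 ∧ (rowSupport A ψ χ 4).card = 2) ∧
      (∀ x ∈ rowSupport A ψ χ 2, ∀ y ∈ rowSupport A ψ χ 2, x + y ∉ rowSupport A ψ χ 4) := by
    intro χ hs H
    have n2 := rowSupport_nonempty (χ := χ).2 h2
    have n3 := rowSupport_nonempty (χ := χ).2 h3
    have n4 := rowSupport_nonempty (χ := χ).2 h4
    obtain ⟨h6, hsf⟩ := sumFree_of_card_rowSupport (i := 3) (j := 4) (k := 2) (cellBound hA hV hs)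
      (by decide) (by decide) (by decide) (by omega) (card_rowSupport_add_le n3 n4 n2 H)
    have H22 := hsf 2 2 4 rfl (by simp) (by simp) (by simp)
    have H44 := hsf 4 4 3 rfl (by simp) (by simp) (by simp)
    have c22 := card_rowSupport_add_le n2 n2 n4 H22
    have c44 := card_rowSupport_add_le n4 n4 n3 H44
    have p2 := n2.card_pos
    have p3 := n3.card_pos
    have p4 := n4.card_pos
    refine ⟨?_, H22⟩
    by_cases h41 : (rowSupport A ψ χ 4).card = 1
    · exfalso
      obtain ⟨c, hc⟩ := Finset.card_eq_one.1 h41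
      have mc : c ∈ rowSupport A ψ χ 4 := by rw [hc]; simp
      have hc2 : 3 * c ∉ rowSupport A ψ χ 2 := by
        intro h
        refine H22 _ h _ h ?_
        have h5 : ∀ c : ZMod 5, 3 * c + 3 * c = c := by decide
        rwa [h5 c]
      have hd : Disjoint (rowSupport A ψ χ 3)
          (insert (2 * c) ((rowSupport A ψ χ 2).image (· - c))) := by
        rw [Finset.disjoint_left]
        intro x hx hx'
        rw [Finset.mem_insert, Finset.mem_image] at hx'
        rcases hx' with rfl | ⟨y, hy, rfl⟩
        · exact H44 c mc c mc (by rwa [← two_mul])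
        · exact H _ hx c mc (by simpa using hy)
      have hu := Finset.card_le_univ
        (rowSupport A ψ χ 3 ∪ insert (2 * c) ((rowSupport A ψ χ 2).image (· - c)))
      rw [Finset.card_union_of_disjoint hd, Finset.card_insert_of_notMem,
        Finset.card_image_of_injective _ (sub_left_injective), ZMod.card] at hu
      · omega
      · rw [Finset.mem_image]
        rintro ⟨y, hy, e⟩
        refine hc2 ?_
        rwa [← show y = 3 * c by rw [sub_eq_iff_eq_add.1 e]; ring]
    · omega
  obtain ⟨⟨c2, _⟩, _⟩ := main χ hs H
  obtain ⟨χ', hs', hS, hT⟩ := exists_shear_of_card_eq_two hs (by decide) c2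
  have H' := hT 3 4 2 rfl H
  obtain ⟨⟨_, c4⟩, H22⟩ := main χ' hs' H'
  have m0 := (hS 0).2 (Or.inl rfl)
  have m1 := (hS 1).2 (Or.inr rfl)
  have hS4 : ∀ x ∈ rowSupport A ψ χ' 4, x = 3 ∨ x = 4 := by
    intro x hx
    rcases ZMod.five_cases x with rfl | rfl | rfl | rfl | rfl
    · exact absurd hx (H22 0 m0 0 m0)
    · exact absurd hx (H22 0 m0 1 m1)
    · exact absurd hx (H22 1 m1 1 m1)
    · simp
    · simp
  obtain ⟨m3, m4⟩ := eq_pair_of_card c4.ge hS4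
  have hS3 : ∀ x ∈ rowSupport A ψ χ' 3, x = 0 ∨ x = 4 := by
    intro x hx
    rcases ZMod.five_cases x with rfl | rfl | rfl | rfl | rfl
    · simp
    · exact absurd m0 (H' 1 hx 4 m4)
    · exact absurd m0 (H' 2 hx 3 m3)
    · exact absurd m1 (H' 3 hx 3 m3)
    · simp
  refine isNormal_of_rows hA hV ψ (χ' + ψ) (i := 2) (j := 3) (k := 4) (by omega)
    (by decide) (by decide) (by decide) ?_
  intro a ha hr
  rw [LinearMap.add_apply]
  rcases hr with h | h | h
  · rcases (hS _).1 (mem_rowSupport.2 ⟨a, ha, h, rfl⟩) with e | e <;> rw [e, h] <;> decide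
  · rcases hS3 _ (mem_rowSupport.2 ⟨a, ha, h, rfl⟩) with e | e <;> rw [e, h] <;> decide
  · rcases hS4 _ (mem_rowSupport.2 ⟨a, ha, h, rfl⟩) with e | e <;> rw [e, h] <;> decide

/-- The rows `0`, `1`, `4`. -/
lemma isNormal_of_rows_zero_one_four [Fintype V] (hA : ∀ a ∈ A, ∀ b ∈ A, a + b ∉ A)
    {m : ℕ} (hM : M = 5 ^ m) (hV : Fintype.card V = Fintype.card (ZMod 5) * (5 * M))
    {ψ : V →ₗ[ZMod 5] ZMod 5} (hψ : Function.Surjective ψ)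
    (hbig : 26 * M < 5 * (fiberCount A ψ 0 + fiberCount A ψ 1 + fiberCount A ψ 4)) :
    IsNormal A := by
  have hMpos : 0 < M := hM ▸ by positivity
  have b1 := fiberCount_le A hV hψ 1
  have b4 := fiberCount_le A hV hψ 4
  rcases Nat.eq_zero_or_pos (fiberCount A ψ 0) with h0 | h0
  · refine isNormal_of_rows hA hV ψ ((2 : ZMod 5) • ψ) (i := 0) (j := 1) (k := 4) (by omega)
      (by decide) (by decide) (by decide) ?_
    intro a ha hr
    rw [LinearMap.smul_apply]
    rcases hr with h | h | h
    · exact absurd (fiberCount_pos.2 ⟨a, ha, h⟩) h0.not_gt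
    · rw [h]; decide
    · rw [h]; decide
  have h11 : fiberCount A ψ 1 + fiberCount A ψ 1 ≤ 5 * M := fiberCount_add_le hA hV hψ h0 1
  have h44 : fiberCount A ψ 4 + fiberCount A ψ 4 ≤ 5 * M := fiberCount_add_le hA hV hψ h0 4
  have h1 : 0 < fiberCount A ψ 1 := by
    by_contra h
    have h4 : 0 < fiberCount A ψ 4 := by
      have h00 : fiberCount A ψ 0 + fiberCount A ψ 0 ≤ 5 * M := fiberCount_add_le hA hV hψ h0 0
      omega
    have : fiberCount A ψ 0 + fiberCount A ψ 4 ≤ 5 * M := fiberCount_add_le hA hV hψ h4 0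
    omega
  have h4 : 0 < fiberCount A ψ 4 := by
    have : fiberCount A ψ 0 + fiberCount A ψ 1 ≤ 5 * M := fiberCount_add_le hA hV hψ h1 0
    omega
  obtain ⟨χ, hs, H⟩ := exists_rowSupport_add_notMem hA hM hV hψ (show (1 + 4 : ZMod 5) = 0 from rfl)
    h1 h4 h0 (by omega)
  have main : ∀ χ : V →ₗ[ZMod 5] ZMod 5, Function.Surjective (ψ.prod χ) →
      (∀ x ∈ rowSupport A ψ χ 1, ∀ y ∈ rowSupport A ψ χ 4, x + y ∉ rowSupport A ψ χ 0) →
      ((rowSupport A ψ χ 1).card = 2 ∧ (rowSupport A ψ χ 0).card = 2) ∧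
      (∀ x ∈ rowSupport A ψ χ 0, ∀ y ∈ rowSupport A ψ χ 1, x + y ∉ rowSupport A ψ χ 1) := by
    intro χ hs H
    have n0 := rowSupport_nonempty (χ := χ).2 h0
    have n1 := rowSupport_nonempty (χ := χ).2 h1
    have n4 := rowSupport_nonempty (χ := χ).2 h4
    obtain ⟨h6, hsf⟩ := sumFree_of_card_rowSupport (i := 1) (j := 4) (k := 0) (cellBound hA hV hs)
      (by decide) (by decide) (by decide) (by omega) (card_rowSupport_add_le n1 n4 n0 H)
    have H00 := hsf 0 0 0 rfl (by simp) (by simp) (by simp)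
    have H01 := hsf 0 1 1 rfl (by simp) (by simp) (by simp)
    have H04 := hsf 0 4 4 rfl (by simp) (by simp) (by simp)
    obtain ⟨x, hx⟩ := n0
    have c0 := two_mul_card_le_five (H00 x hx)
    have c1 := two_mul_card_le_five (H01 x hx)
    have c4 := two_mul_card_le_five (H04 x hx)
    exact ⟨by omega, H01⟩
  obtain ⟨⟨c1, _⟩, _⟩ := main χ hs H
  obtain ⟨χ', hs', hS, hT⟩ := exists_shear_of_card_eq_two hs (by decide) c1
  have H' := hT 1 4 0 rfl H
  obtain ⟨⟨_, c0⟩, H01⟩ := main χ' hs' H'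
  have m0 := (hS 0).2 (Or.inl rfl)
  have m1 := (hS 1).2 (Or.inr rfl)
  have hS0 : ∀ x ∈ rowSupport A ψ χ' 0, x = 2 ∨ x = 3 := by
    intro x hx
    rcases ZMod.five_cases x with rfl | rfl | rfl | rfl | rfl
    · exact absurd m0 (H01 0 hx 0 m0)
    · exact absurd m1 (H01 1 hx 0 m0)
    · simp
    · simp
    · exact absurd m0 (H01 4 hx 1 m1)
  obtain ⟨m2, m3⟩ := eq_pair_of_card c0.ge hS0
  have hS4 : ∀ x ∈ rowSupport A ψ χ' 4, x = 0 ∨ x = 4 := by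
    intro x hx
    rcases ZMod.five_cases x with rfl | rfl | rfl | rfl | rfl
    · simp
    · exact absurd m2 (H' 1 m1 1 hx)
    · exact absurd m2 (H' 0 m0 2 hx)
    · exact absurd m3 (H' 0 m0 3 hx)
    · simp
  refine isNormal_of_rows hA hV ψ (χ' + (2 : ZMod 5) • ψ) (i := 0) (j := 1) (k := 4) (by omega)
    (by decide) (by decide) (by decide) ?_
  intro a ha hr
  rw [LinearMap.add_apply, LinearMap.smul_apply]
  rcases hr with h | h | h
  · rcases hS0 _ (mem_rowSupport.2 ⟨a, ha, h, rfl⟩) with e | e <;> rw [e, h] <;> decide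
  · rcases (hS _).1 (mem_rowSupport.2 ⟨a, ha, h, rfl⟩) with e | e <;> rw [e, h] <;> decide
  · rcases hS4 _ (mem_rowSupport.2 ⟨a, ha, h, rfl⟩) with e | e <;> rw [e, h] <;> decide

/-- Cell version of the rows `0`, `1`, `2`, when row `1` occupies two columns. -/
lemma CellBound.row_two_eq_zero {w : ZMod 5 × ZMod 5 → ℕ} (h : CellBound w M)
    (h10 : 0 < w (1, 0)) (h11 : 0 < w (1, 1)) (h1 : M < w (1, 0) + w (1, 1))
    (hbig : 26 * M < 5 * ((w (0, 2) + w (0, 3)) + (w (1, 0) + w (1, 1)) +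
      (w (2, 0) + w (2, 1) + w (2, 2) + w (2, 3) + w (2, 4)))) :
    w (2, 0) = 0 ∧ w (2, 1) = 0 ∧ w (2, 2) = 0 := by
  have l02 := h.le (0, 2)
  have l03 := h.le (0, 3)
  have l10 := h.le (1, 0)
  have l11 := h.le (1, 1)
  have l23 := h.le (2, 3)
  have l24 := h.le (2, 4)
  have a0 : w (1, 0) + w (2, 0) ≤ M := h.add (1, 0) h10 (1, 0)
  have a2 : w (1, 1) + w (2, 2) ≤ M := h.add (1, 1) h11 (1, 1)
  have s0 : w (2, 0) = 0 ∨ (w (1, 0) + w (1, 0) ≤ M ∧ w (0, 2) + w (2, 3) ≤ M) :=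
    (Nat.eq_zero_or_pos _).imp_right fun hp => ⟨h.sub (2, 0) hp (1, 0), h.sub (2, 0) hp (0, 2)⟩
  have s1 : w (2, 1) = 0 ∨ w (1, 0) + w (1, 1) ≤ M :=
    (Nat.eq_zero_or_pos _).imp_right fun hp => h.sub (2, 1) hp (1, 0)
  have s2 : w (2, 2) = 0 ∨ (w (1, 1) + w (1, 1) ≤ M ∧ w (0, 3) + w (2, 4) ≤ M) :=
    (Nat.eq_zero_or_pos _).imp_right fun hp => ⟨h.sub (2, 2) hp (1, 1), h.sub (2, 2) hp (0, 3)⟩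
  have s3 : w (2, 3) = 0 ∨ w (0, 3) + w (2, 0) ≤ M :=
    (Nat.eq_zero_or_pos _).imp_right fun hp => h.sub (2, 3) hp (0, 3)
  have s4 : w (2, 4) = 0 ∨ w (0, 2) + w (2, 2) ≤ M :=
    (Nat.eq_zero_or_pos _).imp_right fun hp => h.sub (2, 4) hp (0, 2)
  omega

/-- Cell version of the rows `0`, `1`, `2`, when row `2` occupies two columns. -/
lemma CellBound.row_one_eq_zero {w : ZMod 5 × ZMod 5 → ℕ} (h : CellBound w M)
    (h20 : 0 < w (2, 0)) (h21 : 0 < w (2, 1)) (h0 : M < w (0, 2) + w (0, 3))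
    (hbig : 26 * M < 5 * ((w (0, 2) + w (0, 3)) +
      (w (1, 0) + w (1, 1) + w (1, 2) + w (1, 3) + w (1, 4)) + (w (2, 0) + w (2, 1)))) :
    w (1, 0) = 0 ∧ w (1, 3) = 0 ∧ w (1, 4) = 0 := by
  have l02 := h.le (0, 2)
  have l03 := h.le (0, 3)
  have l20 := h.le (2, 0)
  have l21 := h.le (2, 1)
  have h02 : 0 < w (0, 2) := by omega
  have h03 : 0 < w (0, 3) := by omega
  have t02 : w (1, 0) + w (1, 2) ≤ M := h.add (0, 2) h02 (1, 0)
  have t13 : w (1, 1) + w (1, 3) ≤ M := h.add (0, 2) h02 (1, 1)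
  have t24 : w (1, 2) + w (1, 4) ≤ M := h.add (0, 2) h02 (1, 2)
  have t30 : w (1, 3) + w (1, 0) ≤ M := h.add (0, 2) h02 (1, 3)
  have t41 : w (1, 4) + w (1, 1) ≤ M := h.add (0, 2) h02 (1, 4)
  have u00 : w (1, 0) + w (1, 0) ≤ M := h.sub (2, 0) h20 (1, 0)
  have u14 : w (1, 1) + w (1, 4) ≤ M := h.sub (2, 0) h20 (1, 1)
  have u23 : w (1, 2) + w (1, 3) ≤ M := h.sub (2, 0) h20 (1, 2)
  have u01 : w (1, 0) + w (1, 1) ≤ M := h.sub (2, 1) h21 (1, 0)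
  have u33 : w (1, 3) + w (1, 3) ≤ M := h.sub (2, 1) h21 (1, 3)
  have s0 : w (1, 0) = 0 ∨ (w (1, 0) + w (2, 0) ≤ M ∧ w (1, 1) + w (2, 1) ≤ M ∧
      w (0, 2) + w (1, 3) ≤ M ∧ w (0, 3) + w (1, 2) ≤ M) :=
    (Nat.eq_zero_or_pos _).imp_right fun hp =>
      ⟨h.add (1, 0) hp (1, 0), h.add (1, 0) hp (1, 1), h.sub (1, 0) hp (0, 2),
        h.sub (1, 0) hp (0, 3)⟩
  have s1 : w (1, 1) = 0 ∨ (w (1, 4) + w (2, 0) ≤ M ∧ w (1, 0) + w (2, 1) ≤ M ∧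
      w (0, 2) + w (1, 4) ≤ M ∧ w (0, 3) + w (1, 3) ≤ M) :=
    (Nat.eq_zero_or_pos _).imp_right fun hp =>
      ⟨h.add (1, 1) hp (1, 4), h.add (1, 1) hp (1, 0), h.sub (1, 1) hp (0, 2),
        h.sub (1, 1) hp (0, 3)⟩
  have s2 : w (1, 2) = 0 ∨ (w (1, 3) + w (2, 0) ≤ M ∧ w (1, 4) + w (2, 1) ≤ M ∧
      w (0, 2) + w (1, 0) ≤ M ∧ w (0, 3) + w (1, 4) ≤ M) :=
    (Nat.eq_zero_or_pos _).imp_right fun hp =>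
      ⟨h.add (1, 2) hp (1, 3), h.add (1, 2) hp (1, 4), h.sub (1, 2) hp (0, 2),
        h.sub (1, 2) hp (0, 3)⟩
  have s3 : w (1, 3) = 0 ∨ (w (1, 2) + w (2, 0) ≤ M ∧ w (1, 3) + w (2, 1) ≤ M ∧
      w (0, 2) + w (1, 1) ≤ M ∧ w (0, 3) + w (1, 0) ≤ M) :=
    (Nat.eq_zero_or_pos _).imp_right fun hp =>
      ⟨h.add (1, 3) hp (1, 2), h.add (1, 3) hp (1, 3), h.sub (1, 3) hp (0, 2),
        h.sub (1, 3) hp (0, 3)⟩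
  have s4 : w (1, 4) = 0 ∨ (w (1, 1) + w (2, 0) ≤ M ∧ w (1, 2) + w (2, 1) ≤ M ∧
      w (0, 2) + w (1, 2) ≤ M ∧ w (0, 3) + w (1, 1) ≤ M) :=
    (Nat.eq_zero_or_pos _).imp_right fun hp =>
      ⟨h.add (1, 4) hp (1, 1), h.add (1, 4) hp (1, 2), h.sub (1, 4) hp (0, 2),
        h.sub (1, 4) hp (0, 3)⟩
  omega

/-- If the rows `0` and `k` avoid the row `k` at the level of cells, and row `k` is large, then
after a shear row `k` occupies the columns `0`, `1` and row `0` is contained in the columns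
`2`, `3`. -/
lemma exists_columns [Fintype V] (hA : ∀ a ∈ A, ∀ b ∈ A, a + b ∉ A)
    (hV : Fintype.card V = Fintype.card (ZMod 5) * (5 * M)) {ψ χ : V →ₗ[ZMod 5] ZMod 5}
    (hs : Function.Surjective (ψ.prod χ)) {k : ZMod 5} (hk : k ≠ 0) (h0 : 0 < fiberCount A ψ 0)
    (hM : M < fiberCount A ψ k)
    (H : ∀ x ∈ rowSupport A ψ χ 0, ∀ y ∈ rowSupport A ψ χ k, x + y ∉ rowSupport A ψ χ k) :
    ∃ χ' : V →ₗ[ZMod 5] ZMod 5, Function.Surjective (ψ.prod χ') ∧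
      (∀ x, x ∈ rowSupport A ψ χ' k ↔ x = 0 ∨ x = 1) ∧
      ∀ x ∈ rowSupport A ψ χ' 0, x = 2 ∨ x = 3 := by
  have hc := fiberCount_le_card_rowSupport (cellBound hA hV hs) k
  obtain ⟨x, hx⟩ := rowSupport_nonempty (χ := χ).2 h0
  have hc2 := two_mul_card_le_five (H x hx)
  have hc1 : 1 < (rowSupport A ψ χ k).card := by
    by_contra! h
    have := Nat.mul_le_mul_right M h
    omega
  obtain ⟨χ', hs', hS, hT⟩ := exists_shear_of_card_eq_two hs hk
    (show (rowSupport A ψ χ k).card = 2 by omega)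
  refine ⟨χ', hs', hS, ?_⟩
  have H' := hT 0 k k (zero_add k) H
  have m0 := (hS 0).2 (Or.inl rfl)
  have m1 := (hS 1).2 (Or.inr rfl)
  intro x hx
  rcases ZMod.five_cases x with rfl | rfl | rfl | rfl | rfl
  · exact absurd m0 (H' 0 hx 0 m0)
  · exact absurd m1 (H' 1 hx 0 m0)
  · simp
  · simp
  · exact absurd m0 (H' 4 hx 1 m1)

/-- The rows `0`, `1`, `2`. -/
lemma isNormal_of_rows_zero_one_two [Fintype V] (hA : ∀ a ∈ A, ∀ b ∈ A, a + b ∉ A)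
    {m : ℕ} (hM : M = 5 ^ m) (hV : Fintype.card V = Fintype.card (ZMod 5) * (5 * M))
    {ψ : V →ₗ[ZMod 5] ZMod 5} (hψ : Function.Surjective ψ)
    (hbig : 26 * M < 5 * (fiberCount A ψ 0 + fiberCount A ψ 1 + fiberCount A ψ 2)) :
    IsNormal A := by
  have hMpos : 0 < M := hM ▸ by positivity
  have b1 := fiberCount_le A hV hψ 1
  have b2 := fiberCount_le A hV hψ 2
  have h0 : 0 < fiberCount A ψ 0 := by
    by_contra h
    have : fiberCount A ψ 1 + fiberCount A ψ 2 ≤ 5 * M :=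
      fiberCount_add_le hA hV hψ (p := 1) (by omega) 1
    omega
  have h11 : fiberCount A ψ 1 + fiberCount A ψ 1 ≤ 5 * M := fiberCount_add_le hA hV hψ h0 1
  have h22 : fiberCount A ψ 2 + fiberCount A ψ 2 ≤ 5 * M := fiberCount_add_le hA hV hψ h0 2
  have h00 : fiberCount A ψ 0 + fiberCount A ψ 0 ≤ 5 * M := fiberCount_add_le hA hV hψ h0 0
  have h1 : 0 < fiberCount A ψ 1 := by
    by_contra h
    have : fiberCount A ψ 0 + fiberCount A ψ 2 ≤ 5 * M :=
      fiberCount_add_le hA hV hψ (p := 2) (by omega) 0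
    omega
  have h2 : 0 < fiberCount A ψ 2 := by
    have : fiberCount A ψ 0 + fiberCount A ψ 1 ≤ 5 * M := fiberCount_add_le hA hV hψ h1 0
    omega
  have c000 := fiberCount_add_add_le hA hM hV hψ (add_zero 0) h0 h0 h0
  have c011 := fiberCount_add_add_le hA hM hV hψ (zero_add 1) h0 h1 h1
  have c022 := fiberCount_add_add_le hA hM hV hψ (zero_add 2) h0 h2 h2
  have c112 := fiberCount_add_add_le hA hM hV hψ (show (1 + 1 : ZMod 5) = 2 from rfl) h1 h1 h2
  by_cases hk : 26 * M < 5 * (fiberCount A ψ 0 + fiberCount A ψ 1 + fiberCount A ψ 1)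
  · obtain ⟨χ₀, hs₀, H⟩ := exists_rowSupport_add_notMem hA hM hV hψ (zero_add 1) h0 h1 h1 hk
    obtain ⟨χ, hs, hS, hS0⟩ := exists_columns hA hV hs₀ (by decide) h0 (by omega) H
    have e0 := fiberCount_eq_sum A ψ χ 0
    have e1 := fiberCount_eq_sum A ψ χ 1
    have e2 := fiberCount_eq_sum A ψ χ 2
    rw [ZMod.sum_five] at e0 e1 e2
    have z00 := cellCount_eq_zero (fun h => absurd (hS0 0 h) (by decide))
    have z01 := cellCount_eq_zero (fun h => absurd (hS0 1 h) (by decide))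
    have z04 := cellCount_eq_zero (fun h => absurd (hS0 4 h) (by decide))
    have z12 := cellCount_eq_zero (fun h => absurd ((hS 2).1 h) (by decide))
    have z13 := cellCount_eq_zero (fun h => absurd ((hS 3).1 h) (by decide))
    have z14 := cellCount_eq_zero (fun h => absurd ((hS 4).1 h) (by decide))
    obtain ⟨z20, z21, z22⟩ := (cellBound hA hV hs).row_two_eq_zero
      (cellCount_pos.2 ((hS 0).2 (Or.inl rfl))) (cellCount_pos.2 ((hS 1).2 (Or.inr rfl)))
      (by omega) (by omega)
    have hS2 : ∀ x ∈ rowSupport A ψ χ 2, x = 3 ∨ x = 4 := by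
      intro x hx
      rcases ZMod.five_cases x with rfl | rfl | rfl | rfl | rfl
      · exact absurd (cellCount_pos.2 hx) (by omega)
      · exact absurd (cellCount_pos.2 hx) (by omega)
      · exact absurd (cellCount_pos.2 hx) (by omega)
      · simp
      · simp
    refine isNormal_of_rows hA hV ψ (χ + (2 : ZMod 5) • ψ) (i := 0) (j := 1) (k := 2) (by omega)
      (by decide) (by decide) (by decide) ?_
    intro a ha hr
    rw [LinearMap.add_apply, LinearMap.smul_apply]
    rcases hr with h | h | h
    · rcases hS0 _ (mem_rowSupport.2 ⟨a, ha, h, rfl⟩) with e | e <;> rw [e, h] <;> decide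
    · rcases (hS _).1 (mem_rowSupport.2 ⟨a, ha, h, rfl⟩) with e | e <;> rw [e, h] <;> decide
    · rcases hS2 _ (mem_rowSupport.2 ⟨a, ha, h, rfl⟩) with e | e <;> rw [e, h] <;> decide
  · obtain ⟨χ₀, hs₀, H⟩ := exists_rowSupport_add_notMem hA hM hV hψ (zero_add 2) h0 h2 h2
      (by omega)
    obtain ⟨χ, hs, hS, hS0⟩ := exists_columns hA hV hs₀ (by decide) h0 (by omega) H
    have e0 := fiberCount_eq_sum A ψ χ 0
    have e1 := fiberCount_eq_sum A ψ χ 1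
    have e2 := fiberCount_eq_sum A ψ χ 2
    rw [ZMod.sum_five] at e0 e1 e2
    have z00 := cellCount_eq_zero (fun h => absurd (hS0 0 h) (by decide))
    have z01 := cellCount_eq_zero (fun h => absurd (hS0 1 h) (by decide))
    have z04 := cellCount_eq_zero (fun h => absurd (hS0 4 h) (by decide))
    have z22 := cellCount_eq_zero (fun h => absurd ((hS 2).1 h) (by decide))
    have z23 := cellCount_eq_zero (fun h => absurd ((hS 3).1 h) (by decide))
    have z24 := cellCount_eq_zero (fun h => absurd ((hS 4).1 h) (by decide))
    have l20 := (cellBound hA hV hs).le (2, 0)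
    have l21 := (cellBound hA hV hs).le (2, 1)
    obtain ⟨z10, z13, z14⟩ := (cellBound hA hV hs).row_one_eq_zero
      (cellCount_pos.2 ((hS 0).2 (Or.inl rfl))) (cellCount_pos.2 ((hS 1).2 (Or.inr rfl)))
      (by omega) (by omega)
    have hS1 : ∀ x ∈ rowSupport A ψ χ 1, x = 1 ∨ x = 2 := by
      intro x hx
      rcases ZMod.five_cases x with rfl | rfl | rfl | rfl | rfl
      · exact absurd (cellCount_pos.2 hx) (by omega)
      · simp
      · simp
      · exact absurd (cellCount_pos.2 hx) (by omega)
      · exact absurd (cellCount_pos.2 hx) (by omega)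
    refine isNormal_of_rows hA hV ψ (χ + ψ) (i := 0) (j := 1) (k := 2) (by omega)
      (by decide) (by decide) (by decide) ?_
    intro a ha hr
    rw [LinearMap.add_apply]
    rcases hr with h | h | h
    · rcases hS0 _ (mem_rowSupport.2 ⟨a, ha, h, rfl⟩) with e | e <;> rw [e, h] <;> decide
    · rcases hS1 _ (mem_rowSupport.2 ⟨a, ha, h, rfl⟩) with e | e <;> rw [e, h] <;> decide
    · rcases (hS _).1 (mem_rowSupport.2 ⟨a, ha, h, rfl⟩) with e | e <;> rw [e, h] <;> decide

/-- Three values in `ZMod 5` can be scaled into one of three standard triples. -/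
lemma exists_scaled_triple (x y z : ZMod 5) : ∃ u : ZMod 5, u ≠ 0 ∧
    ∃ t : ZMod 5 × ZMod 5 × ZMod 5, (t = (2, 3, 4) ∨ t = (0, 1, 4) ∨ t = (0, 1, 2)) ∧
      ∀ c, c = x ∨ c = y ∨ c = z → u * c = t.1 ∨ u * c = t.2.1 ∨ u * c = t.2.2 := by
  have h : ∀ x y z : ZMod 5, ∃ u : ZMod 5, u ≠ 0 ∧
      ((∀ c, c = x ∨ c = y ∨ c = z → u * c = 2 ∨ u * c = 3 ∨ u * c = 4) ∨
      (∀ c, c = x ∨ c = y ∨ c = z → u * c = 0 ∨ u * c = 1 ∨ u * c = 4) ∨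
      (∀ c, c = x ∨ c = y ∨ c = z → u * c = 0 ∨ u * c = 1 ∨ u * c = 2)) := by decide
  obtain ⟨u, hu, h | h | h⟩ := h x y z
  · exact ⟨u, hu, _, Or.inl rfl, h⟩
  · exact ⟨u, hu, _, Or.inr (Or.inl rfl), h⟩
  · exact ⟨u, hu, _, Or.inr (Or.inr rfl), h⟩

/-- A sum-free set with many elements in three rows of a functional is normal. -/
lemma isNormal_of_three_rows [Fintype V] (hA : ∀ a ∈ A, ∀ b ∈ A, a + b ∉ A)
    {m : ℕ} (hM : M = 5 ^ m) (hV : Fintype.card V = Fintype.card (ZMod 5) * (5 * M))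
    {ψ : V →ₗ[ZMod 5] ZMod 5} (hψ : Function.Surjective ψ) {x y z : ZMod 5}
    (hbig : 26 * M < 5 * (A.filter fun a => ψ a = x ∨ ψ a = y ∨ ψ a = z).card) :
    IsNormal A := by
  classical
  obtain ⟨u, hu, t, ht, h⟩ := exists_scaled_triple x y z
  have hs : Function.Surjective (u • ψ) := by
    intro c
    obtain ⟨v, hv⟩ := hψ (u⁻¹ * c)
    exact ⟨v, by simp [hv, hu]⟩
  have hle : (A.filter fun a => ψ a = x ∨ ψ a = y ∨ ψ a = z).card ≤
      fiberCount A (u • ψ) t.1 + fiberCount A (u • ψ) t.2.1 + fiberCount A (u • ψ) t.2.2 := by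
    unfold fiberCount
    refine (Finset.card_le_card ?_).trans ((Finset.card_union_le (_ ∪ _) _).trans
      (Nat.add_le_add_right (Finset.card_union_le _ _) _))
    intro a ha
    rw [Finset.mem_filter] at ha
    simp only [Finset.mem_union, Finset.mem_filter, LinearMap.smul_apply, smul_eq_mul]
    have := h _ ha.2
    tauto
  rcases ht with rfl | rfl | rfl
  · exact isNormal_of_rows_two_three_four hA hM hV hs (by dsimp only at hle; omega)
  · exact isNormal_of_rows_zero_one_four hA hM hV hs (by dsimp only at hle; omega)
  · exact isNormal_of_rows_zero_one_two hA hM hV hs (by dsimp only at hle; omega)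

end Rows

end Characteristic

theorem stmt_18 (n : ℕ) (hn : 2 ≤ n) (A : Set (Fin n → ZMod 5))
    (hsf : ∀ a ∈ A, ∀ b ∈ A, a + b ∉ A)
    (W : Submodule (ZMod 5) (Fin n → ZMod 5))
    (hW : Module.finrank (ZMod 5) W = n - 1)
    (v : Fin n → ZMod 5) (hv : v ∉ W)
    (x₁ x₂ x₃ : ZMod 5)
    (hbig : 125 * (A ∩ {a | a - x₁ • v ∈ W ∨ a - x₂ • v ∈ W ∨ a - x₃ • v ∈ W}).ncard
              > 26 * 5 ^ n) :
    ∃ V : Submodule (ZMod 5) (Fin n → ZMod 5), Module.finrank (ZMod 5) V = n - 1 ∧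
      ∃ w : Fin n → ZMod 5, w ∉ V ∧
        A ⊆ ((2 : ZMod 5) • w +ᵥ (V : Set (Fin n → ZMod 5))) ∪
            ((3 : ZMod 5) • w +ᵥ (V : Set (Fin n → ZMod 5))) := by
  classical
  have := fact_prime_five
  obtain ⟨m, rfl⟩ := Nat.exists_eq_add_of_le' hn
  obtain ⟨χ, hχv, hχ⟩ := Submodule.exists_le_ker_of_notMem hv
  have hψ : Function.Surjective χ := LinearMap.surjective fun h => hχv (by rw [h]; rfl)
  have hrow : ∀ a x, a - x • v ∈ W → χ a = x * χ v := by
    intro a x h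
    have := hχ h
    rwa [LinearMap.mem_ker, map_sub, map_smul, smul_eq_mul, sub_eq_zero] at this
  have hV : Fintype.card (Fin (m + 2) → ZMod 5) = Fintype.card (ZMod 5) * (5 * 5 ^ m) := by
    rw [Fintype.card_pi, Finset.prod_const, Finset.card_univ, Fintype.card_fin, ZMod.card]
    ring
  have hle : (A ∩ {a | a - x₁ • v ∈ W ∨ a - x₂ • v ∈ W ∨ a - x₃ • v ∈ W}).ncard ≤
      (A.toFinset.filter fun a => χ a = x₁ * χ v ∨ χ a = x₂ * χ v ∨ χ a = x₃ * χ v).card := by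
    rw [← Set.ncard_coe_finset]
    refine Set.ncard_le_ncard ?_ (Set.toFinite _)
    rintro a ⟨ha, h⟩
    rw [Finset.mem_coe, Finset.mem_filter, Set.mem_toFinset]
    exact ⟨ha, h.imp (hrow _ _) (Or.imp (hrow _ _) (hrow _ _))⟩
  have hpow : (5 : ℕ) ^ (m + 2) = 25 * 5 ^ m := by ring
  obtain ⟨l, hl, h⟩ := isNormal_of_three_rows (A := A.toFinset) (M := 5 ^ m) (by simpa using hsf)
    rfl hV hψ (x := x₁ * χ v) (y := x₂ * χ v) (z := x₃ * χ v) (by omega)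
  have hls : Function.Surjective l := LinearMap.surjective hl
  refine ⟨LinearMap.ker l, ?_, ?_⟩
  · have h1 := LinearMap.finrank_range_add_finrank_ker l
    rw [LinearMap.range_eq_top.2 hls, finrank_top, Module.finrank_self, Module.finrank_fin_fun]
      at h1
    omega
  · obtain ⟨w, hw⟩ := hls 1
    have key : ∀ a c, l a = c → a ∈ c • w +ᵥ (LinearMap.ker l : Set (Fin (m + 2) → ZMod 5)) := by
      intro a c ha
      rw [Set.mem_vadd_set_iff_neg_vadd_mem, SetLike.mem_coe, LinearMap.mem_ker, vadd_eq_add,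
        map_add, map_neg, map_smul, hw, ha, smul_eq_mul, mul_one, neg_add_cancel]
    refine ⟨w, by simp [hw], fun a ha => ?_⟩
    exact (h a (Set.mem_toFinset.2 ha)).imp (key a 2) (key a 3)
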